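/- Fix an integer n ≥ 4 and let d = r2/r1. There exists a constant C > 0, independent of r1, r2 and ε, such that for all r1, r2 > 0 and all sufficiently small ε > 0: (1/C) ≤ Σ_{m=0}^{∞} q_{1,m}^{n−2} ≤ C and (1/C) ≤ Σ_{m=0}^{∞} q_{2,m}^{n−2} ≤ C; (1/C)·(1/(d+1)) ≤ Q1 ≤ C·(1/(d+1)) and (1/C)·(d/(d+1)) ≤ Q2 ≤ C·(d/(d+1)); and (1/C)·r_s ≤ (−1)^{s+1}·( Σ_{k=0}^{∞} c_{s,2k}·q_{s,2k}^{n−2} − Σ_{k=0}^{∞} c_{s,2k+1}·q_{s,2k+1}^{n−2} ) ≤ C·r_s for s = 1, 2, where c_{s,m} denotes the x1-coordinate of the point c_{s,m}. -/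

import Mathlib

open MeasureTheory Metric Filter Asymptotics
open scoped RealInnerProductSpace Topology

noncomputable section

/-- `n`-dimensional Euclidean space. -/
abbrev ES (n : ℕ) : Type := EuclideanSpace ℝ (Fin n)

/-- The Laplacian of `u` at `x`: the sum of the pure second partial derivatives. -/
def lap {n : ℕ} (u : ES n → ℝ) (x : ES n) : ℝ :=
  ∑ i : Fin n,
    fderiv ℝ (fun y => fderiv ℝ u y (EuclideanSpace.single i 1)) x (EuclideanSpace.single i 1)

/-- `u` is harmonic on `s`: it is twice differentiable and its Laplacian vanishes on `s`. -/
def HarmOn {n : ℕ} (u : ES n → ℝ) (s : Set (ES n)) : Prop :=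
  ContDiffOn ℝ 2 u s ∧ ∀ x ∈ s, lap u x = 0

/-- `∫_{∂B_r(c)} (∂_ν u) · w dS` : the integral over the sphere of radius `r` centered at `c`
of the outward normal derivative of `u` times the weight `w`, with respect to the
`(n-1)`-dimensional Hausdorff (surface) measure. -/
def fluxW {n : ℕ} (u w : ES n → ℝ) (c : ES n) (r : ℝ) : ℝ :=
  ∫ x in sphere c r, (⟪gradient u x, r⁻¹ • (x - c)⟫ * w x) ∂(μH[(n - 1 : ℝ)])

/-- `∫_{∂B_r(c)} ∂_ν u dS` : the total outward flux of `u` through the sphere. -/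
def flux {n : ℕ} (u : ES n → ℝ) (c : ES n) (r : ℝ) : ℝ :=
  fluxW u (fun _ => 1) c r

/-- `u` solves the conductivity problem for the entire harmonic function `H` and the
perfect conductors `B(c₁,r₁)`, `B(c₂,r₂)`, taking the constant values `v₁`, `v₂` on the
respective boundary spheres. -/
structure IsCondSol {n : ℕ} (c₁ c₂ : ES n) (r₁ r₂ : ℝ) (H u : ES n → ℝ)
    (v₁ v₂ : ℝ) : Prop where
  cont : ContinuousOn u (ball c₁ r₁ ∪ ball c₂ r₂)ᶜ
  harm : HarmOn u (closedBall c₁ r₁ ∪ closedBall c₂ r₂)ᶜ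
  decay : (fun x => u x - H x) =O[Bornology.cobounded (ES n)] fun x => ‖x‖ ^ (1 - (n : ℝ))
  bdry₁ : ∀ x ∈ sphere c₁ r₁, u x = v₁
  bdry₂ : ∀ x ∈ sphere c₂ r₂, u x = v₂
  flux₁ : flux u c₁ r₁ = 0
  flux₂ : flux u c₂ r₂ = 0

/-- Reflection (inversion) with respect to the sphere of center `c` and radius `r`:
`R(x) = c + r²(x−c)/|x−c|²`. -/
def reflBall {n : ℕ} (c : ES n) (r : ℝ) (x : ES n) : ES n :=
  c + (r ^ 2 / ‖x - c‖ ^ 2) • (x - c)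

/-- The sequence of reflected centers `c_{s,m}`, starting from the center `c₁` of the first
ball: `c_{s,0} = c₁`, `c_{s,2k+1} = R₂(c_{s,2k})`, `c_{s,2k+2} = R₁(c_{s,2k+1})`
(the sequence for `s = 2` is obtained by swapping the roles of the two balls). -/
def cSeq {n : ℕ} (c₁ c₂ : ES n) (r₁ r₂ : ℝ) : ℕ → ES n
  | 0 => c₁
  | m + 1 =>
    if m % 2 = 0 then reflBall c₂ r₂ (cSeq c₁ c₂ r₁ r₂ m)
    else reflBall c₁ r₁ (cSeq c₁ c₂ r₁ r₂ m)

/-- The contraction factors `ρ_{s,j}`: `ρ_{s,0} = 1`,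
`ρ_{s,2k+1} = r₂/|c₂ − c_{s,2k}|`, `ρ_{s,2k+2} = r₁/|c₁ − c_{s,2k+1}|`. -/
def rhoSeq {n : ℕ} (c₁ c₂ : ES n) (r₁ r₂ : ℝ) : ℕ → ℝ
  | 0 => 1
  | m + 1 =>
    if m % 2 = 0 then r₂ / ‖c₂ - cSeq c₁ c₂ r₁ r₂ m‖
    else r₁ / ‖c₁ - cSeq c₁ c₂ r₁ r₂ m‖

/-- `q_{s,m} = ∏_{j=0}^m ρ_{s,j}`. -/
def qSeq {n : ℕ} (c₁ c₂ : ES n) (r₁ r₂ : ℝ) (m : ℕ) : ℝ :=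
  ∏ j ∈ Finset.range (m + 1), rhoSeq c₁ c₂ r₁ r₂ j

/-- `Q_s = Σ_{m=0}^∞ (−1)^m q_{s,m}^{n−2}`. -/
def QSum (n : ℕ) (c₁ c₂ : ES n) (r₁ r₂ : ℝ) : ℝ :=
  ∑' m : ℕ, (-1 : ℝ) ^ m * qSeq c₁ c₂ r₁ r₂ m ^ (n - 2)

/-- `M = Q₂·Σ_k q_{1,2k}^{n−2} + Q₁·Σ_k q_{2,2k+1}^{n−2}`. -/
def MSum (n : ℕ) (c₁ c₂ : ES n) (r₁ r₂ : ℝ) : ℝ :=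
  QSum n c₂ c₁ r₂ r₁ * ∑' k : ℕ, qSeq c₁ c₂ r₁ r₂ (2 * k) ^ (n - 2) +
    QSum n c₁ c₂ r₁ r₂ * ∑' k : ℕ, qSeq c₂ c₁ r₂ r₁ (2 * k + 1) ^ (n - 2)

/-- `ωₙ`: the surface area of the unit sphere in `ℝⁿ`, as the `(n−1)`-dimensional
Hausdorff measure of the unit sphere. -/
def sphereArea (n : ℕ) : ℝ := (μH[(n - 1 : ℝ)] (sphere (0 : ES n) 1)).toReal

/-- The candidate dual function
`h(x) = (1/((2−n)ωₙM))·[Q₂·Σ_m (−1)^m q_{1,m}^{n−2}/|x−c_{1,m}|^{n−2}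
        − Q₁·Σ_m (−1)^m q_{2,m}^{n−2}/|x−c_{2,m}|^{n−2}]`. -/
def hFun (n : ℕ) (c₁ c₂ : ES n) (r₁ r₂ : ℝ) (x : ES n) : ℝ :=
  (1 / ((2 - (n : ℝ)) * sphereArea n * MSum n c₁ c₂ r₁ r₂)) *
    (QSum n c₂ c₁ r₂ r₁ *
        ∑' m : ℕ, (-1 : ℝ) ^ m * qSeq c₁ c₂ r₁ r₂ m ^ (n - 2) /
          ‖x - cSeq c₁ c₂ r₁ r₂ m‖ ^ (n - 2)
      - QSum n c₁ c₂ r₁ r₂ *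
        ∑' m : ℕ, (-1 : ℝ) ^ m * qSeq c₂ c₁ r₂ r₁ m ^ (n - 2) /
          ‖x - cSeq c₂ c₁ r₂ r₁ m‖ ^ (n - 2))

/-- For two balls of radii `a`, `b` whose centers are at distance `D`, the distance from the
`m`-th reflected center (starting at the center of the ball of radius `a`) to the center of the
ball in which it is reflected next. -/
def gapSeq (a b D : ℝ) : ℕ → ℝ
  | 0 => D
  | m + 1 => D - (if m % 2 = 0 then b else a) ^ 2 / gapSeq a b D m

lemma gapSeq_bounds {a b D : ℝ} (ha : 0 < a) (hb : 0 < b) (hD : a + b ≤ D) (k : ℕ) :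
    b * ((k + 1) * (a + b)) / (b + k * (a + b)) ≤ gapSeq a b D (2 * k) ∧
      a * (b + (k + 1) * (a + b)) / ((k + 1) * (a + b)) ≤ gapSeq a b D (2 * k + 1) := by
  have hodd : ∀ k : ℕ,
      b * ((k + 1) * (a + b)) / (b + k * (a + b)) ≤ gapSeq a b D (2 * k) →
      a * (b + (k + 1) * (a + b)) / ((k + 1) * (a + b)) ≤ gapSeq a b D (2 * k + 1) := by
    intro k h
    have h1 : gapSeq a b D (2 * k + 1) = D - b ^ 2 / gapSeq a b D (2 * k) := by simp [gapSeq]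
    have h2 : b ^ 2 / gapSeq a b D (2 * k) ≤
        b ^ 2 / (b * ((k + 1) * (a + b)) / (b + k * (a + b))) := by gcongr
    have h3 : a * (b + (k + 1) * (a + b)) / ((k + 1) * (a + b)) =
        a + b - b ^ 2 / (b * ((k + 1) * (a + b)) / (b + k * (a + b))) := by
      field_simp
      ring
    linarith
  have heven : b * ((k + 1) * (a + b)) / (b + k * (a + b)) ≤ gapSeq a b D (2 * k) := by
    induction k with
    | zero =>
      have : b * (a + b) / b = a + b := by field_simp
      simpa [gapSeq, this] using hD
    | succ k ih =>
      have h := hodd k ih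
      have h1 : gapSeq a b D (2 * (k + 1)) = D - a ^ 2 / gapSeq a b D (2 * k + 1) := by
        rw [show 2 * (k + 1) = 2 * k + 1 + 1 by ring, gapSeq]
        simp [show (2 * k + 1) % 2 = 1 by omega]
      have h2 : a ^ 2 / gapSeq a b D (2 * k + 1) ≤
          a ^ 2 / (a * (b + (k + 1) * (a + b)) / ((k + 1) * (a + b))) := by gcongr
      have h3 : b * ((k + 1 + 1) * (a + b)) / (b + (k + 1) * (a + b)) =
          a + b - a ^ 2 / (a * (b + (k + 1) * (a + b)) / ((k + 1) * (a + b))) := by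
        field_simp
        ring
      push_cast
      linarith
  exact ⟨heven, hodd k heven⟩

lemma le_gapSeq {a b D : ℝ} (ha : 0 < a) (hb : 0 < b) (hD : a + b ≤ D) (k : ℕ) :
    b ≤ gapSeq a b D (2 * k) ∧ a ≤ gapSeq a b D (2 * k + 1) := by
  obtain ⟨h1, h2⟩ := gapSeq_bounds ha hb hD k
  refine ⟨le_trans ?_ h1, le_trans ?_ h2⟩
  · rw [le_div_iff₀ (by positivity)]
    gcongr
    linarith
  · rw [le_div_iff₀ (by positivity)]
    gcongr
    linarith

lemma gapSeq_pos {a b D : ℝ} (ha : 0 < a) (hb : 0 < b) (hD : a + b ≤ D) (m : ℕ) :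
    0 < gapSeq a b D m := by
  rcases Nat.even_or_odd' m with ⟨k, rfl | rfl⟩
  · exact hb.trans_le (le_gapSeq ha hb hD k).1
  · exact ha.trans_le (le_gapSeq ha hb hD k).2

lemma gapSeq_le {a b D : ℝ} (ha : 0 < a) (hb : 0 < b) (hD : a + b ≤ D) (m : ℕ) :
    gapSeq a b D m ≤ D := by
  cases m with
  | zero => exact le_rfl
  | succ m =>
    have := gapSeq_pos ha hb hD m
    rw [gapSeq]
    exact sub_le_self _ (by positivity)

lemma add_le_gapSeq_even {a b ε : ℝ} (ha : 0 < a) (hb : 0 < b) (hε : 0 < ε) (k : ℕ) :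
    b + ε ≤ gapSeq a b (a + b + 2 * ε) (2 * k) := by
  cases k with
  | zero => simp only [gapSeq]; linarith
  | succ k =>
    have h := (le_gapSeq ha hb (show a + b ≤ a + b + 2 * ε by linarith) k).2
    have h1 : gapSeq a b (a + b + 2 * ε) (2 * (k + 1)) =
        a + b + 2 * ε - a ^ 2 / gapSeq a b (a + b + 2 * ε) (2 * k + 1) := by
      rw [show 2 * (k + 1) = 2 * k + 1 + 1 by ring, gapSeq]
      simp [show (2 * k + 1) % 2 = 1 by omega]
    have h2 : a ^ 2 / gapSeq a b (a + b + 2 * ε) (2 * k + 1) ≤ a := by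
      rw [div_le_iff₀ (ha.trans_le h)]
      nlinarith
    linarith

section Collinear

variable {n : ℕ} {e : ES n} {a b ε : ℝ}

lemma cSeq_eq_smul (he : ‖e‖ = 1) (ha : 0 < a) (hb : 0 < b) (hε : 0 < ε) (m : ℕ) :
    cSeq ((a + ε) • e) (-((b + ε) • e)) a b m =
      (if m % 2 = 0 then gapSeq a b (a + b + 2 * ε) m - (b + ε)
        else a + ε - gapSeq a b (a + b + 2 * ε) m) • e := by
  have hD : a + b ≤ a + b + 2 * ε := by linarith
  induction m with
  | zero =>
    simp only [cSeq, gapSeq, Nat.zero_mod, if_true]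
    congr 1
    ring
  | succ m ih =>
    have hg := gapSeq_pos ha hb hD m
    set g := gapSeq a b (a + b + 2 * ε) m with hgdef
    rcases Nat.mod_two_eq_zero_or_one m with h | h
    · have h' : (m + 1) % 2 = 1 := by omega
      have hx : (g - (b + ε)) • e - -((b + ε) • e) = g • e := by module
      simp only [cSeq, ih, h, h', gapSeq, ← hgdef, if_true, reflBall, hx, norm_smul, he,
        Real.norm_eq_abs, mul_one, sq_abs, smul_smul, one_ne_zero, if_false]
      rw [← neg_smul, ← add_smul]
      congr 1
      field_simp
      ring
    · have h' : (m + 1) % 2 = 0 := by omega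
      have hx : (a + ε - g) • e - (a + ε) • e = (-g) • e := by module
      simp only [cSeq, ih, h, h', gapSeq, ← hgdef, if_true, reflBall, hx, norm_smul, he,
        Real.norm_eq_abs, mul_one, sq_abs, smul_smul, one_ne_zero, if_false]
      rw [← add_smul]
      congr 1
      field_simp
      ring

lemma rhoSeq_succ_eq (he : ‖e‖ = 1) (ha : 0 < a) (hb : 0 < b) (hε : 0 < ε) (m : ℕ) :
    rhoSeq ((a + ε) • e) (-((b + ε) • e)) a b (m + 1) =
      (if m % 2 = 0 then b else a) / gapSeq a b (a + b + 2 * ε) m := by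
  have hg := gapSeq_pos ha hb (show a + b ≤ a + b + 2 * ε by linarith) m
  have key : ∀ t : ℝ, |t| = gapSeq a b (a + b + 2 * ε) m →
      ‖t • e‖ = gapSeq a b (a + b + 2 * ε) m := by
    intro t ht
    rw [norm_smul, he, mul_one, Real.norm_eq_abs, ht]
  set g := gapSeq a b (a + b + 2 * ε) m with hgdef
  rw [rhoSeq, cSeq_eq_smul he ha hb hε, ← hgdef]
  split_ifs with h
  · rw [show -((b + ε) • e) - (g - (b + ε)) • e = (-g) • e by module,
      key _ (by rw [abs_neg, abs_of_pos hg])]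
  · rw [show (a + ε) • e - (a + ε - g) • e = g • e by module, key _ (abs_of_pos hg)]

lemma qSeq_zero {c₁ c₂ : ES n} {r₁ r₂ : ℝ} : qSeq c₁ c₂ r₁ r₂ 0 = 1 := by
  simp [qSeq, rhoSeq]

lemma qSeq_succ_eq (he : ‖e‖ = 1) (ha : 0 < a) (hb : 0 < b) (hε : 0 < ε) (m : ℕ) :
    qSeq ((a + ε) • e) (-((b + ε) • e)) a b (m + 1) =
      qSeq ((a + ε) • e) (-((b + ε) • e)) a b m *
        ((if m % 2 = 0 then b else a) / gapSeq a b (a + b + 2 * ε) m) := by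
  rw [qSeq, Finset.prod_range_succ, rhoSeq_succ_eq he ha hb hε, qSeq]

lemma qSeq_odd_eq (he : ‖e‖ = 1) (ha : 0 < a) (hb : 0 < b) (hε : 0 < ε) (k : ℕ) :
    qSeq ((a + ε) • e) (-((b + ε) • e)) a b (2 * k + 1) =
      qSeq ((a + ε) • e) (-((b + ε) • e)) a b (2 * k) *
        (b / gapSeq a b (a + b + 2 * ε) (2 * k)) := by
  rw [qSeq_succ_eq he ha hb hε]
  simp

lemma qSeq_nonneg (he : ‖e‖ = 1) (ha : 0 < a) (hb : 0 < b) (hε : 0 < ε) (m : ℕ) :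
    0 ≤ qSeq ((a + ε) • e) (-((b + ε) • e)) a b m := by
  induction m with
  | zero => simp [qSeq_zero]
  | succ m ih =>
    rw [qSeq_succ_eq he ha hb hε]
    have hg := gapSeq_pos ha hb (show a + b ≤ a + b + 2 * ε by linarith) m
    split_ifs <;> positivity

lemma qSeq_bounds (he : ‖e‖ = 1) (ha : 0 < a) (hb : 0 < b) (hε : 0 < ε) (k : ℕ) :
    qSeq ((a + ε) • e) (-((b + ε) • e)) a b (2 * k) ≤ b / (b + k * (a + b)) ∧
      qSeq ((a + ε) • e) (-((b + ε) • e)) a b (2 * k + 1) ≤ b / ((k + 1) * (a + b)) := by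
  have hD : a + b ≤ a + b + 2 * ε := by linarith
  have hq := qSeq_nonneg he ha hb hε
  have hodd : ∀ k : ℕ,
      qSeq ((a + ε) • e) (-((b + ε) • e)) a b (2 * k) ≤ b / (b + k * (a + b)) →
      qSeq ((a + ε) • e) (-((b + ε) • e)) a b (2 * k + 1) ≤ b / ((k + 1) * (a + b)) := by
    intro k h
    have hg := (gapSeq_bounds ha hb hD k).1
    have hg0 := gapSeq_pos ha hb hD (2 * k)
    rw [qSeq_odd_eq he ha hb hε]
    calc _ ≤ b / (b + k * (a + b)) *
          (b / (b * ((k + 1) * (a + b)) / (b + k * (a + b)))) := by gcongr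
      _ = _ := by field_simp
  have heven : qSeq ((a + ε) • e) (-((b + ε) • e)) a b (2 * k) ≤ b / (b + k * (a + b)) := by
    induction k with
    | zero => simp [qSeq_zero, hb.ne']
    | succ k ih =>
      have hg := (gapSeq_bounds ha hb hD k).2
      have hg0 := gapSeq_pos ha hb hD (2 * k + 1)
      have h := hodd k ih
      rw [show 2 * (k + 1) = 2 * k + 1 + 1 by ring, qSeq_succ_eq he ha hb hε,
        if_neg (by omega)]
      push_cast
      calc _ ≤ b / ((k + 1) * (a + b)) *
            (a / (a * (b + (k + 1) * (a + b)) / ((k + 1) * (a + b)))) := by gcongr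
        _ = _ := by field_simp
  exact ⟨heven, hodd k heven⟩

lemma qSeq_le (he : ‖e‖ = 1) (ha : 0 < a) (hb : 0 < b) (hε : 0 < ε) (m : ℕ) :
    qSeq ((a + ε) • e) (-((b + ε) • e)) a b m ≤ 2 / (m + 1) ∧
      qSeq ((a + ε) • e) (-((b + ε) • e)) a b m ≤ 1 := by
  rcases Nat.even_or_odd' m with ⟨k, rfl | rfl⟩
  · have h := (qSeq_bounds he ha hb hε k).1
    refine ⟨h.trans ?_, h.trans ?_⟩
    · push_cast
      rw [div_le_div_iff₀ (by positivity) (by positivity)]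
      have : 0 ≤ (k : ℝ) * a := by positivity
      nlinarith
    · rw [div_le_one (by positivity)]
      exact le_add_of_nonneg_right (by positivity)
  · have h := (qSeq_bounds he ha hb hε k).2
    have hk : 0 ≤ (k : ℝ) * (a + b) := by positivity
    refine ⟨h.trans ?_, h.trans ?_⟩
    · push_cast
      rw [div_le_div_iff₀ (by positivity) (by positivity)]
      have : 0 ≤ (k : ℝ) * a := by positivity
      nlinarith
    · rw [div_le_one (by positivity)]
      nlinarith

lemma qSeq_pow_le (he : ‖e‖ = 1) (ha : 0 < a) (hb : 0 < b) (hε : 0 < ε) {N : ℕ} (hN : 2 ≤ N)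
    (m : ℕ) : qSeq ((a + ε) • e) (-((b + ε) • e)) a b m ^ N ≤ (2 / ((m : ℝ) + 1)) ^ 2 := by
  have hq := qSeq_nonneg he ha hb hε m
  obtain ⟨h1, h2⟩ := qSeq_le he ha hb hε m
  calc _ ≤ qSeq ((a + ε) • e) (-((b + ε) • e)) a b m ^ 2 := pow_le_pow_of_le_one hq h2 hN
    _ ≤ _ := by gcongr

lemma summable_two_div_add_one_sq : Summable fun m : ℕ => (2 / ((m : ℝ) + 1)) ^ 2 := by
  have h := ((summable_nat_add_iff 1).2
    (Real.summable_one_div_nat_pow.2 (one_lt_two : 1 < 2))).mul_left 4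
  refine h.congr fun m => ?_
  push_cast
  field_simp
  norm_num

lemma summable_qSeq_pow (he : ‖e‖ = 1) (ha : 0 < a) (hb : 0 < b) (hε : 0 < ε) {N : ℕ}
    (hN : 2 ≤ N) : Summable fun m => qSeq ((a + ε) • e) (-((b + ε) • e)) a b m ^ N :=
  summable_two_div_add_one_sq.of_nonneg_of_le
    (fun m => pow_nonneg (qSeq_nonneg he ha hb hε m) N) (qSeq_pow_le he ha hb hε hN)

lemma summable_qSeq_pow_even (he : ‖e‖ = 1) (ha : 0 < a) (hb : 0 < b) (hε : 0 < ε) {N : ℕ}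
    (hN : 2 ≤ N) :
    Summable fun k : ℕ => qSeq ((a + ε) • e) (-((b + ε) • e)) a b (2 * k) ^ N :=
  (summable_qSeq_pow he ha hb hε hN).comp_injective (i := fun k : ℕ => 2 * k)
    fun x y h => by simpa using h

lemma summable_qSeq_pow_odd (he : ‖e‖ = 1) (ha : 0 < a) (hb : 0 < b) (hε : 0 < ε) {N : ℕ}
    (hN : 2 ≤ N) :
    Summable fun k : ℕ => qSeq ((a + ε) • e) (-((b + ε) • e)) a b (2 * k + 1) ^ N :=
  (summable_qSeq_pow he ha hb hε hN).comp_injective (i := fun k : ℕ => 2 * k + 1)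
    fun x y h => by simpa using h

lemma tsum_qSeq_pow_le (he : ‖e‖ = 1) (ha : 0 < a) (hb : 0 < b) (hε : 0 < ε) {N : ℕ}
    (hN : 2 ≤ N) : ∑' m, qSeq ((a + ε) • e) (-((b + ε) • e)) a b m ^ N ≤
      ∑' m : ℕ, (2 / ((m : ℝ) + 1)) ^ 2 :=
  (summable_qSeq_pow he ha hb hε hN).tsum_le_tsum (qSeq_pow_le he ha hb hε hN)
    summable_two_div_add_one_sq

lemma one_le_tsum_qSeq_pow (he : ‖e‖ = 1) (ha : 0 < a) (hb : 0 < b) (hε : 0 < ε) {N : ℕ}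
    (hN : 2 ≤ N) : 1 ≤ ∑' m, qSeq ((a + ε) • e) (-((b + ε) • e)) a b m ^ N := by
  have h := (summable_qSeq_pow he ha hb hε hN).le_tsum 0
    fun m _ => pow_nonneg (qSeq_nonneg he ha hb hε m) N
  simpa [qSeq_zero] using h

lemma tsum_qSeq_pow_even_odd_le (he : ‖e‖ = 1) (ha : 0 < a) (hb : 0 < b) (hε : 0 < ε) {N : ℕ}
    (hN : 2 ≤ N) :
    ∑' k : ℕ, qSeq ((a + ε) • e) (-((b + ε) • e)) a b (2 * k) ^ N ≤
        ∑' m : ℕ, (2 / ((m : ℝ) + 1)) ^ 2 ∧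
      ∑' k : ℕ, qSeq ((a + ε) • e) (-((b + ε) • e)) a b (2 * k + 1) ^ N ≤
        ∑' m : ℕ, (2 / ((m : ℝ) + 1)) ^ 2 := by
  have h := tsum_even_add_odd
    (f := fun m => qSeq ((a + ε) • e) (-((b + ε) • e)) a b m ^ N)
    (summable_qSeq_pow_even he ha hb hε hN) (summable_qSeq_pow_odd he ha hb hε hN)
  have hle := tsum_qSeq_pow_le he ha hb hε hN
  have hq := qSeq_nonneg he ha hb hε
  have h0 : 0 ≤ ∑' k : ℕ, qSeq ((a + ε) • e) (-((b + ε) • e)) a b (2 * k) ^ N :=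
    tsum_nonneg fun k => pow_nonneg (hq _) N
  have h1 : 0 ≤ ∑' k : ℕ, qSeq ((a + ε) • e) (-((b + ε) • e)) a b (2 * k + 1) ^ N :=
    tsum_nonneg fun k => pow_nonneg (hq _) N
  constructor <;> linarith

lemma one_sub_div_gapSeq_even_le (ha : 0 < a) (hb : 0 < b) (hε : 0 < ε) (k : ℕ) :
    1 - b / gapSeq a b (a + b + 2 * ε) (2 * k) ≤ (a + 2 * ε) / (a + b) := by
  have hD : a + b ≤ a + b + 2 * ε := by linarith
  have hg := gapSeq_pos ha hb hD (2 * k)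
  have h1 : b / (a + b + 2 * ε) ≤ b / gapSeq a b (a + b + 2 * ε) (2 * k) := by
    gcongr
    exact gapSeq_le ha hb hD _
  have h2 : (a + 2 * ε) / (a + b + 2 * ε) ≤ (a + 2 * ε) / (a + b) := by gcongr
  have h3 : 1 - b / (a + b + 2 * ε) = (a + 2 * ε) / (a + b + 2 * ε) := by
    field_simp
    ring
  linarith

lemma hasSum_QSum (he : ‖e‖ = 1) (ha : 0 < a) (hb : 0 < b) (hε : 0 < ε) (hn : 4 ≤ n) :
    HasSum (fun k : ℕ => qSeq ((a + ε) • e) (-((b + ε) • e)) a b (2 * k) ^ (n - 2) *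
        (1 - (b / gapSeq a b (a + b + 2 * ε) (2 * k)) ^ (n - 2)))
      (QSum n ((a + ε) • e) (-((b + ε) • e)) a b) := by
  have hN : 2 ≤ n - 2 := by omega
  have hE := summable_qSeq_pow_even he ha hb hε hN
  have hO := summable_qSeq_pow_odd he ha hb hε hN
  have h1 := tsum_even_add_odd
    (f := fun m => (-1 : ℝ) ^ m * qSeq ((a + ε) • e) (-((b + ε) • e)) a b m ^ (n - 2))
    (by simpa [pow_mul] using hE) (by simpa [pow_mul, pow_succ] using hO.neg)
  have h2 := hE.hasSum.sub hO.hasSum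
  have h3 : QSum n ((a + ε) • e) (-((b + ε) • e)) a b =
      (∑' k : ℕ, qSeq ((a + ε) • e) (-((b + ε) • e)) a b (2 * k) ^ (n - 2)) -
      ∑' k : ℕ, qSeq ((a + ε) • e) (-((b + ε) • e)) a b (2 * k + 1) ^ (n - 2) := by
    rw [QSum, ← h1, sub_eq_add_neg, ← tsum_neg]
    simp [pow_mul, pow_succ]
  rw [h3]
  refine h2.congr_fun ?_
  intro k
  rw [qSeq_odd_eq he ha hb hε, mul_pow]
  ring

lemma QSum_bounds (he : ‖e‖ = 1) (ha : 0 < a) (hb : 0 < b) (hε : 0 < ε) (hεa : 2 * ε ≤ a)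
    (hn : 4 ≤ n) :
    a / (a + b) ≤ QSum n ((a + ε) • e) (-((b + ε) • e)) a b ∧
      QSum n ((a + ε) • e) (-((b + ε) • e)) a b ≤
        2 * (n - 2 : ℕ) * (∑' m : ℕ, (2 / ((m : ℝ) + 1)) ^ 2) * (a / (a + b)) := by
  have hN : 2 ≤ n - 2 := by omega
  have hD : a + b ≤ a + b + 2 * ε := by linarith
  have hsum := hasSum_QSum he ha hb hε hn
  have hE := summable_qSeq_pow_even he ha hb hε hN
  have hq := qSeq_nonneg he ha hb hε
  have ht0 : ∀ k, 0 ≤ b / gapSeq a b (a + b + 2 * ε) (2 * k) := fun k => by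
    have := gapSeq_pos ha hb hD (2 * k)
    positivity
  have ht1 : ∀ k, b / gapSeq a b (a + b + 2 * ε) (2 * k) ≤ 1 := fun k =>
    (div_le_one (gapSeq_pos ha hb hD (2 * k))).2 (le_gapSeq ha hb hD k).1
  constructor
  · have h0 := le_hasSum hsum 0 fun k _ =>
      mul_nonneg (pow_nonneg (hq _) _) (sub_nonneg.2 (pow_le_one₀ (ht0 k) (ht1 k)))
    have h1 : (b / gapSeq a b (a + b + 2 * ε) (2 * 0)) ^ (n - 2) ≤ b / (a + b) := by
      refine (pow_le_of_le_one (ht0 0) (ht1 0) (by omega)).trans ?_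
      simp only [gapSeq]
      gcongr
    have h2 : a / (a + b) = 1 - b / (a + b) := by
      field_simp
      ring
    rw [mul_zero] at h1
    simp only [mul_zero, qSeq_zero, one_pow, one_mul] at h0
    linarith
  · have hterm : ∀ k : ℕ, 1 - (b / gapSeq a b (a + b + 2 * ε) (2 * k)) ^ (n - 2) ≤
        (n - 2 : ℕ) * (2 * a / (a + b)) := by
      intro k
      have hB := one_add_mul_le_pow (a := b / gapSeq a b (a + b + 2 * ε) (2 * k) - 1)
        (by linarith [ht0 k]) (n - 2)
      rw [add_sub_cancel] at hB
      have h1 : 1 - b / gapSeq a b (a + b + 2 * ε) (2 * k) ≤ 2 * a / (a + b) :=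
        (one_sub_div_gapSeq_even_le ha hb hε k).trans (by gcongr; linarith)
      have h2 : ((n - 2 : ℕ) : ℝ) * (1 - b / gapSeq a b (a + b + 2 * ε) (2 * k)) ≤
          (n - 2 : ℕ) * (2 * a / (a + b)) := by gcongr
      linarith
    have hle := hasSum_le
      (fun k => mul_le_mul_of_nonneg_left (hterm k) (pow_nonneg (hq (2 * k)) (n - 2)))
      hsum (hE.hasSum.mul_right _)
    refine hle.trans ?_
    calc _ ≤ (∑' m : ℕ, (2 / ((m : ℝ) + 1)) ^ 2) * ((n - 2 : ℕ) * (2 * a / (a + b))) := by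
          exact mul_le_mul_of_nonneg_right (tsum_qSeq_pow_even_odd_le he ha hb hε hN).1
            (by positivity)
      _ = _ := by ring

lemma tsum_weighted_bounds (he : ‖e‖ = 1) (ha : 0 < a) (hb : 0 < b) (hε : 0 < ε)
    (hεa : 2 * ε ≤ a) {N : ℕ} (hN : 2 ≤ N) (i : Fin n) :
    ∃ T : ℝ, a ≤ T ∧ T ≤ 5 * (∑' m : ℕ, (2 / ((m : ℝ) + 1)) ^ 2) * a ∧
      (∑' k : ℕ, (cSeq ((a + ε) • e) (-((b + ε) • e)) a b (2 * k)) i *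
          qSeq ((a + ε) • e) (-((b + ε) • e)) a b (2 * k) ^ N) -
        (∑' k : ℕ, (cSeq ((a + ε) • e) (-((b + ε) • e)) a b (2 * k + 1)) i *
          qSeq ((a + ε) • e) (-((b + ε) • e)) a b (2 * k + 1) ^ N) = e i * T := by
  have hD : a + b ≤ a + b + 2 * ε := by linarith
  have hE := summable_qSeq_pow_even he ha hb hε hN
  have hO := summable_qSeq_pow_odd he ha hb hε hN
  have hq := qSeq_nonneg he ha hb hε
  obtain ⟨hSE, hSO⟩ := tsum_qSeq_pow_even_odd_le he ha hb hε hN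
  set S := ∑' m : ℕ, (2 / ((m : ℝ) + 1)) ^ 2
  set g := gapSeq a b (a + b + 2 * ε) with hg
  set q := qSeq ((a + ε) • e) (-((b + ε) • e)) a b
  set x : ℕ → ℝ := fun k => g (2 * k) - (b + ε) with hx
  set y : ℕ → ℝ := fun k => g (2 * k + 1) - (a + ε) with hy
  have hx0 : ∀ k, 0 ≤ x k := fun k => sub_nonneg.2 (add_le_gapSeq_even ha hb hε k)
  have hx1 : ∀ k, x k ≤ 2 * a := fun k => by
    have := gapSeq_le ha hb hD (2 * k)
    simp only [hx]
    linarith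
  have hyeq : ∀ k, y k = ε + b * (1 - b / g (2 * k)) := fun k => by
    simp only [hy, hg, gapSeq]
    simp
    ring
  have hy0 : ∀ k, 0 ≤ y k := fun k => by
    have : b / g (2 * k) ≤ 1 :=
      (div_le_one (gapSeq_pos ha hb hD (2 * k))).2 (le_gapSeq ha hb hD k).1
    rw [hyeq]
    have : 0 ≤ b * (1 - b / g (2 * k)) := mul_nonneg hb.le (by linarith)
    linarith
  have hy1 : ∀ k, y k ≤ 3 * a := fun k => by
    rw [hyeq]
    have h1 : b * (1 - b / g (2 * k)) ≤ b * ((a + 2 * ε) / (a + b)) := by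
      gcongr
      exact one_sub_div_gapSeq_even_le ha hb hε k
    have h2 : b * ((a + 2 * ε) / (a + b)) ≤ a + 2 * ε := by
      rw [← mul_div_assoc, div_le_iff₀ (by positivity)]
      nlinarith
    linarith
  have hxs : Summable fun k => x k * q (2 * k) ^ N :=
    (hE.mul_left (2 * a)).of_nonneg_of_le
      (fun k => mul_nonneg (hx0 k) (pow_nonneg (hq _) N))
      fun k => mul_le_mul_of_nonneg_right (hx1 k) (pow_nonneg (hq _) N)
  have hys : Summable fun k => y k * q (2 * k + 1) ^ N :=
    (hO.mul_left (3 * a)).of_nonneg_of_le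
      (fun k => mul_nonneg (hy0 k) (pow_nonneg (hq _) N))
      fun k => mul_le_mul_of_nonneg_right (hy1 k) (pow_nonneg (hq _) N)
  refine ⟨(∑' k, x k * q (2 * k) ^ N) + ∑' k, y k * q (2 * k + 1) ^ N, ?_, ?_, ?_⟩
  · have h1 := hxs.le_tsum 0 fun k _ => mul_nonneg (hx0 k) (pow_nonneg (hq _) N)
    have h2 : 0 ≤ ∑' k, y k * q (2 * k + 1) ^ N :=
      tsum_nonneg fun k => mul_nonneg (hy0 k) (pow_nonneg (hq _) N)
    have h3 : x 0 * q (2 * 0) ^ N = a + ε := by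
      simp only [hx, hg, q, mul_zero, gapSeq, qSeq_zero, one_pow]
      ring
    linarith
  · have h1 : ∑' k, x k * q (2 * k) ^ N ≤ 2 * a * S := by
      refine (hxs.tsum_le_tsum (fun k => mul_le_mul_of_nonneg_right (hx1 k)
        (pow_nonneg (hq _) N)) (hE.mul_left (2 * a))).trans ?_
      rw [tsum_mul_left]
      gcongr
    have h2 : ∑' k, y k * q (2 * k + 1) ^ N ≤ 3 * a * S := by
      refine (hys.tsum_le_tsum (fun k => mul_le_mul_of_nonneg_right (hy1 k)
        (pow_nonneg (hq _) N)) (hO.mul_left (3 * a))).trans ?_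
      rw [tsum_mul_left]
      gcongr
    linarith
  · rw [mul_add, ← tsum_mul_left, ← tsum_mul_left, sub_eq_add_neg, ← tsum_neg]
    congr 1
    · refine tsum_congr fun k => ?_
      rw [cSeq_eq_smul he ha hb hε, if_pos (by omega), PiLp.smul_apply, smul_eq_mul]
      ring
    · refine tsum_congr fun k => ?_
      rw [cSeq_eq_smul he ha hb hε, if_neg (by omega), PiLp.smul_apply, smul_eq_mul]
      simp only [hy]
      ring

end Collinear

/-- **Lemma 4.7 (higher dimensions `n ≥ 4`).**
With `d = r₂/r₁`, there is `C > 0`, independent of `r₁`, `r₂`, `ε`, such that for all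
`r₁, r₂ > 0` and all sufficiently small `ε > 0`:
`1/C ≤ Σ_m q_{1,m}^{n−2} ≤ C`, `1/C ≤ Σ_m q_{2,m}^{n−2} ≤ C`,
`(1/C)(1/(d+1)) ≤ Q₁ ≤ C(1/(d+1))`, `(1/C)(d/(d+1)) ≤ Q₂ ≤ C(d/(d+1))`, and
`r_s/C ≤ (−1)^{s+1}(Σ_k c_{s,2k}q_{s,2k}^{n−2} − Σ_k c_{s,2k+1}q_{s,2k+1}^{n−2}) ≤ C·r_s`
for `s = 1, 2`, where `c_{s,m}` also denotes the `x₁`-coordinate of the reflected center. -/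
theorem qSum_QSum_cq_estimates_high_dim (n : ℕ) (hn : 4 ≤ n) :
    ∃ C : ℝ, 0 < C ∧
      ∀ r₁ r₂ : ℝ, 0 < r₁ → 0 < r₂ → ∃ ε₀ : ℝ, 0 < ε₀ ∧
        ∀ ε : ℝ, 0 < ε → ε < ε₀ →
          ∀ c₁ c₂ : ES n,
            c₁ = EuclideanSpace.single (⟨0, by omega⟩ : Fin n) (r₁ + ε) →
            c₂ = EuclideanSpace.single (⟨0, by omega⟩ : Fin n) (-(r₂ + ε)) →
              ((1 / C ≤ ∑' m : ℕ, qSeq c₁ c₂ r₁ r₂ m ^ (n - 2) ∧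
                  ∑' m : ℕ, qSeq c₁ c₂ r₁ r₂ m ^ (n - 2) ≤ C) ∧
                (1 / C ≤ ∑' m : ℕ, qSeq c₂ c₁ r₂ r₁ m ^ (n - 2) ∧
                  ∑' m : ℕ, qSeq c₂ c₁ r₂ r₁ m ^ (n - 2) ≤ C)) ∧
              ((1 / C) * (1 / (r₂ / r₁ + 1)) ≤ QSum n c₁ c₂ r₁ r₂ ∧
                QSum n c₁ c₂ r₁ r₂ ≤ C * (1 / (r₂ / r₁ + 1)) ∧
                (1 / C) * ((r₂ / r₁) / (r₂ / r₁ + 1)) ≤ QSum n c₂ c₁ r₂ r₁ ∧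
                QSum n c₂ c₁ r₂ r₁ ≤ C * ((r₂ / r₁) / (r₂ / r₁ + 1))) ∧
              ((1 / C) * r₁ ≤
                  (∑' k : ℕ, (cSeq c₁ c₂ r₁ r₂ (2 * k)) ⟨0, by omega⟩ *
                      qSeq c₁ c₂ r₁ r₂ (2 * k) ^ (n - 2)) -
                    (∑' k : ℕ, (cSeq c₁ c₂ r₁ r₂ (2 * k + 1)) ⟨0, by omega⟩ *
                      qSeq c₁ c₂ r₁ r₂ (2 * k + 1) ^ (n - 2)) ∧
                (∑' k : ℕ, (cSeq c₁ c₂ r₁ r₂ (2 * k)) ⟨0, by omega⟩ *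
                    qSeq c₁ c₂ r₁ r₂ (2 * k) ^ (n - 2)) -
                  (∑' k : ℕ, (cSeq c₁ c₂ r₁ r₂ (2 * k + 1)) ⟨0, by omega⟩ *
                    qSeq c₁ c₂ r₁ r₂ (2 * k + 1) ^ (n - 2)) ≤ C * r₁ ∧
                (1 / C) * r₂ ≤
                  -((∑' k : ℕ, (cSeq c₂ c₁ r₂ r₁ (2 * k)) ⟨0, by omega⟩ *
                      qSeq c₂ c₁ r₂ r₁ (2 * k) ^ (n - 2)) -
                    (∑' k : ℕ, (cSeq c₂ c₁ r₂ r₁ (2 * k + 1)) ⟨0, by omega⟩ *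
                      qSeq c₂ c₁ r₂ r₁ (2 * k + 1) ^ (n - 2))) ∧
                -((∑' k : ℕ, (cSeq c₂ c₁ r₂ r₁ (2 * k)) ⟨0, by omega⟩ *
                    qSeq c₂ c₁ r₂ r₁ (2 * k) ^ (n - 2)) -
                  (∑' k : ℕ, (cSeq c₂ c₁ r₂ r₁ (2 * k + 1)) ⟨0, by omega⟩ *
                    qSeq c₂ c₁ r₂ r₁ (2 * k + 1) ^ (n - 2))) ≤ C * r₂) := by
  have hN : 2 ≤ n - 2 := by omega
  set S : ℝ := ∑' m : ℕ, (2 / ((m : ℝ) + 1)) ^ 2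
  have hS0 : 0 ≤ S := tsum_nonneg fun m => by positivity
  have hNS : 0 ≤ 2 * ((n - 2 : ℕ) : ℝ) * S := by positivity
  set C : ℝ := 1 + 5 * S + 2 * ((n - 2 : ℕ) : ℝ) * S
  have hC1 : 1 ≤ C := by linarith
  have hC' : 1 / C ≤ 1 := (div_le_one (by linarith)).2 hC1
  refine ⟨C, by linarith, fun r₁ r₂ h₁ h₂ => ⟨min r₁ r₂ / 2, by positivity, ?_⟩⟩
  intro ε hε hε' c₁ c₂ hc₁ hc₂
  have hε₁ : 2 * ε ≤ r₁ := by linarith [min_le_left r₁ r₂]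
  have hε₂ : 2 * ε ≤ r₂ := by linarith [min_le_right r₁ r₂]
  set i : Fin n := ⟨0, by omega⟩
  set e : ES n := EuclideanSpace.single i 1 with he_def
  have he : ‖e‖ = 1 := by simp [he_def]
  have he' : ‖-e‖ = 1 := by rw [norm_neg, he]
  have hei : e i = 1 := by simp [he_def]
  have hc₁' : c₁ = (r₁ + ε) • e := by
    ext j
    simp [hc₁, he_def]
  have hc₂' : c₂ = -((r₂ + ε) • e) := by
    ext j
    by_cases hj : j = i <;> simp [hc₂, he_def, hj]
  have hsw₁ : (r₂ + ε) • -e = c₂ := by rw [hc₂', smul_neg]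
  have hsw₂ : -((r₁ + ε) • -e) = c₁ := by rw [hc₁', smul_neg, neg_neg]
  have hq₁ := one_le_tsum_qSeq_pow he h₁ h₂ hε hN
  have hq₁' := tsum_qSeq_pow_le he h₁ h₂ hε hN
  have hq₂ := one_le_tsum_qSeq_pow he' h₂ h₁ hε hN
  have hq₂' := tsum_qSeq_pow_le he' h₂ h₁ hε hN
  obtain ⟨hQ₁, hQ₁'⟩ := QSum_bounds he h₁ h₂ hε hε₁ hn
  obtain ⟨hQ₂, hQ₂'⟩ := QSum_bounds he' h₂ h₁ hε hε₂ hn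
  obtain ⟨T₁, hT₁, hT₁', hT₁e⟩ := tsum_weighted_bounds he h₁ h₂ hε hε₁ hN i
  obtain ⟨T₂, hT₂, hT₂', hT₂e⟩ := tsum_weighted_bounds he' h₂ h₁ hε hε₂ hN i
  rw [← hc₁', ← hc₂'] at hq₁ hq₁' hQ₁ hQ₁' hT₁e
  rw [hsw₁, hsw₂] at hq₂ hq₂' hQ₂ hQ₂' hT₂e
  have hd₁ : 1 / (r₂ / r₁ + 1) = r₁ / (r₁ + r₂) := by
    field_simp
    ring
  have hd₂ : r₂ / r₁ / (r₂ / r₁ + 1) = r₂ / (r₂ + r₁) := by field_simp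
  have hlow : ∀ t : ℝ, 0 ≤ t → 1 / C * t ≤ t := fun t ht => mul_le_of_le_one_left ht hC'
  have hupQ : ∀ t : ℝ, 0 ≤ t → 2 * ((n - 2 : ℕ) : ℝ) * S * t ≤ C * t := fun t ht =>
    mul_le_mul_of_nonneg_right (by linarith) ht
  have hupT : ∀ t : ℝ, 0 ≤ t → 5 * S * t ≤ C * t := fun t ht =>
    mul_le_mul_of_nonneg_right (by linarith) ht
  have hf₁ : 0 ≤ r₁ / (r₁ + r₂) := by positivity
  have hf₂ : 0 ≤ r₂ / (r₂ + r₁) := by positivity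
  rw [hd₁, hd₂, hT₁e, hT₂e, PiLp.neg_apply, hei, neg_one_mul, neg_neg, one_mul]
  exact ⟨⟨⟨by linarith, by linarith⟩, by linarith, by linarith⟩,
    ⟨(hlow _ hf₁).trans hQ₁, hQ₁'.trans (hupQ _ hf₁), (hlow _ hf₂).trans hQ₂,
      hQ₂'.trans (hupQ _ hf₂)⟩,
    (hlow _ h₁.le).trans hT₁, hT₁'.trans (hupT _ h₁.le), (hlow _ h₂.le).trans hT₂,
    hT₂'.trans (hupT _ h₂.le)⟩
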